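/- arXiv:1705.09123 — 2 statements merged into one kernel-verified Lean document; each statement's English description precedes it below -/
import Mathlib

section
/- Let K be the attractor of an IFS of similitudes on a complete metric space, endowed with its natural fractal structure. Then the natural fractal structure is irreducible if and only if it is a tiling. -/
open scoped ENNReal

namespace IFSMoran

variable {X : Type*} [MetricSpace X]

/-- The map `f_i = f_{i1} o ... o f_{in}` associated to a word `i = i1...in`
(a list of indices). -/
def wMap {k : ℕ} (f : Fin k → X → X) : List (Fin k) → X → X
  | [] => id
  | i :: w => f i ∘ wMap f w

/-- The piece `A_i = f_i(K)` of the natural fractal structure. -/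
def piece {k : ℕ} (f : Fin k → X → X) (K : Set X) (w : List (Fin k)) : Set X :=
  wMap f w '' K

/-- The natural fractal structure (levels indexed by words) is irreducible:
no level admits a proper subcovering. -/
def Irred {k : ℕ} (f : Fin k → X → X) (K : Set X) : Prop :=
  ∀ w : List (Fin k),
    ¬ piece f K w ⊆ ⋃ v ∈ {v : List (Fin k) | v.length = w.length ∧ v ≠ w}, piece f K v

/-- `H³ₙˢ(K) = inf_{l ≥ n} ∑_{i ∈ Σˡ} diam (A_i) ^ s`. -/
noncomputable def H3n {k : ℕ} (f : Fin k → X → X) (K : Set X) (s : ℝ) (n : ℕ) : ℝ≥0∞ :=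
  ⨅ (l : ℕ) (_ : n ≤ l),
    ∑ w : Fin l → Fin k, EMetric.diam (piece f K (List.ofFn w)) ^ s

/-- `H³ˢ(K) = lim_n H³ₙˢ(K)`; the sequence is nondecreasing in `n`, so the limit
is the supremum. -/
noncomputable def H3 {k : ℕ} (f : Fin k → X → X) (K : Set X) (s : ℝ) : ℝ≥0∞ :=
  ⨆ n, H3n f K s n

/-- Fractal dimension III: `dim³(K) = inf {s ≥ 0 : H³ˢ(K) = 0}`. -/
noncomputable def dim3 {k : ℕ} (f : Fin k → X → X) (K : Set X) : ℝ :=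
  sInf {s : ℝ | 0 ≤ s ∧ H3 f K s = 0}

/-- `H⁴ₙˢ(K)`: infimum of `∑ diam (A_i) ^ s` over finite coverings of `K` by
pieces indexed by words of length `≥ n`. -/
noncomputable def H4n {k : ℕ} (f : Fin k → X → X) (K : Set X) (s : ℝ) (n : ℕ) : ℝ≥0∞ :=
  ⨅ (𝒜 : Finset (List (Fin k))) (_ : ∀ w ∈ 𝒜, n ≤ w.length)
      (_ : K ⊆ ⋃ w ∈ 𝒜, piece f K w),
    ∑ w ∈ 𝒜, EMetric.diam (piece f K w) ^ s

/-- `H⁴ˢ(K) = lim_n H⁴ₙˢ(K)`; the sequence is nondecreasing in `n`, so the limit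
is the supremum. -/
noncomputable def H4 {k : ℕ} (f : Fin k → X → X) (K : Set X) (s : ℝ) : ℝ≥0∞ :=
  ⨆ n, H4n f K s n

/-- Fractal dimension IV: `dim⁴(K) = inf {s ≥ 0 : H⁴ˢ(K) = 0}`. -/
noncomputable def dim4 {k : ℕ} (f : Fin k → X → X) (K : Set X) : ℝ :=
  sInf {s : ℝ | 0 ≤ s ∧ H4 f K s = 0}

/-- Interior of `A` relative to `K` (as a subset of the ambient space `X`). -/
def intK (K A : Set X) : Set X := K \ closure (K \ A)

/-- The level separation property: interiors (in `K`) of two pieces indexed by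
distinct words of the same length are disjoint (LSP1), and every piece has
nonempty interior in `K` (LSP2). -/
def LSP {k : ℕ} (f : Fin k → X → X) (K : Set X) : Prop :=
  (∀ v w : List (Fin k), v.length = w.length → v ≠ w →
      intK K (piece f K v) ∩ intK K (piece f K w) = ∅) ∧
  ∀ w : List (Fin k), (intK K (piece f K w)).Nonempty

/-- The natural fractal structure is a tiling: pieces indexed by distinct words
of the same length have disjoint interiors in `K`, and every piece is regularly
closed in `K`, i.e. `cl_K (int_K (A_i)) = A_i`. -/
def IsTiling {k : ℕ} (f : Fin k → X → X) (K : Set X) : Prop :=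
  (∀ v w : List (Fin k), v.length = w.length → v ≠ w →
      intK K (piece f K v) ∩ intK K (piece f K w) = ∅) ∧
  ∀ w : List (Fin k), closure (intK K (piece f K w)) ∩ K = piece f K w


theorem mem_intK_iff {K A : Set X} {x : X} :
    x ∈ intK K A ↔ x ∈ K ∧ ∃ ε > 0, Metric.ball x ε ∩ K ⊆ A := by
  unfold intK
  rw [Set.mem_sdiff, Metric.mem_closure_iff]
  refine and_congr_right fun _ => ?_
  push Not
  refine exists_congr fun ε => and_congr_right fun _ => ⟨?_, ?_⟩
  · rintro h y ⟨hy, hyK⟩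
    by_contra hyA
    exact (h y ⟨hyK, hyA⟩).not_gt (by rwa [dist_comm])
  · rintro h y ⟨hyK, hyA⟩
    by_contra hlt
    exact hyA (h ⟨by rw [Metric.mem_ball, dist_comm]; exact not_le.mp hlt, hyK⟩)

theorem intK_subset {K A : Set X} : intK K A ⊆ A := fun x hx => by
  obtain ⟨hxK, ε, hε, h⟩ := mem_intK_iff.mp hx
  exact h ⟨Metric.mem_ball_self hε, hxK⟩

theorem intK_mono {K A B : Set X} (h : A ⊆ B) : intK K A ⊆ intK K B :=
  Set.sdiff_subset_sdiff_right (closure_mono (Set.sdiff_subset_sdiff_right h))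

theorem wMap_append {Y : Type*} {k : ℕ} (f : Fin k → Y → Y) (v w : List (Fin k)) :
    wMap f (v ++ w) = wMap f v ∘ wMap f w := by
  induction v with
  | nil => rfl
  | cons i v ih => simp [wMap, ih, Function.comp_assoc]

theorem piece_append {Y : Type*} {k : ℕ} (f : Fin k → Y → Y) (K : Set Y) (v w : List (Fin k)) :
    piece f K (v ++ w) = wMap f v '' piece f K w := by
  rw [piece, wMap_append, Set.image_comp, piece]

theorem piece_subset {Y : Type*} {k : ℕ} {f : Fin k → Y → Y} {K : Set Y} (hK : K = ⋃ i, f i '' K)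
    (w : List (Fin k)) : piece f K w ⊆ K := by
  induction w with
  | nil => simp [piece, wMap]
  | cons i w ih =>
    rw [← List.singleton_append, piece_append]
    nth_rewrite 2 [hK]
    exact (Set.image_mono ih).trans (Set.subset_iUnion (fun i => f i '' K) i)

theorem piece_append_subset {Y : Type*} {k : ℕ} {f : Fin k → Y → Y} {K : Set Y}
    (hK : K = ⋃ i, f i '' K) (v w : List (Fin k)) : piece f K (v ++ w) ⊆ piece f K v := by
  rw [piece_append]
  exact Set.image_mono (piece_subset hK w)

theorem exists_mem_piece {Y : Type*} {k : ℕ} {f : Fin k → Y → Y} {K : Set Y}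
    (hK : K = ⋃ i, f i '' K) (n : ℕ) {x : Y} (hx : x ∈ K) :
    ∃ w : List (Fin k), w.length = n ∧ x ∈ piece f K w := by
  induction n generalizing x with
  | zero => exact ⟨[], rfl, x, hx, rfl⟩
  | succ n ih =>
    rw [hK] at hx
    obtain ⟨i, y, hy, rfl⟩ := Set.mem_iUnion.mp hx
    obtain ⟨w, rfl, z, hz, rfl⟩ := ih hy
    exact ⟨i :: w, rfl, z, hz, rfl⟩

theorem exists_mem_piece_append {Y : Type*} {k : ℕ} {f : Fin k → Y → Y} {K : Set Y}
    (hK : K = ⋃ i, f i '' K) (n : ℕ) {v : List (Fin k)} {x : Y} (hx : x ∈ piece f K v) :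
    ∃ u : List (Fin k), u.length = n ∧ x ∈ piece f K (v ++ u) := by
  obtain ⟨y, hy, rfl⟩ := hx
  obtain ⟨u, hu, hyu⟩ := exists_mem_piece hK n hy
  exact ⟨u, hu, piece_append f K v u ▸ Set.mem_image_of_mem _ hyu⟩

theorem dist_wMap_le {k : ℕ} {f : Fin k → X → X} {r : ℝ} (hr : 0 ≤ r)
    (hf : ∀ i x y, dist (f i x) (f i y) ≤ r * dist x y) (w : List (Fin k)) (x y : X) :
    dist (wMap f w x) (wMap f w y) ≤ r ^ w.length * dist x y := by
  induction w with
  | nil => simp [wMap]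
  | cons i w ih =>
    calc dist (f i (wMap f w x)) (f i (wMap f w y))
        ≤ r * (r ^ w.length * dist x y) :=
          (hf i _ _).trans (mul_le_mul_of_nonneg_left ih hr)
      _ = r ^ (i :: w).length * dist x y := by rw [List.length_cons]; ring

theorem isClosed_piece {k : ℕ} {f : Fin k → X → X} {r : ℝ} (hr : 0 ≤ r)
    (hf : ∀ i x y, dist (f i x) (f i y) ≤ r * dist x y) {K : Set X} (hKcp : IsCompact K)
    (w : List (Fin k)) : IsClosed (piece f K w) :=
  (hKcp.image (LipschitzWith.of_dist_le_mul (K := ⟨r ^ w.length, pow_nonneg hr _⟩)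
    (dist_wMap_le hr hf w)).continuous).isClosed

theorem exists_piece_append_subset_ball {k : ℕ} {f : Fin k → X → X} {r : ℝ} (hr : 0 ≤ r)
    (hr1 : r < 1) (hf : ∀ i x y, dist (f i x) (f i y) ≤ r * dist x y) {K : Set X}
    (hKcp : IsCompact K) (hK : K = ⋃ i, f i '' K) {v : List (Fin k)} {x : X}
    (hx : x ∈ piece f K v) {ε : ℝ} (hε : 0 < ε) :
    ∃ u : List (Fin k), piece f K (v ++ u) ⊆ Metric.ball x ε := by
  obtain ⟨n, hn⟩ : ∃ n : ℕ, r ^ n * Metric.diam K < ε := by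
    have h := (tendsto_pow_atTop_nhds_zero_of_lt_one hr hr1).mul_const (Metric.diam K)
    rw [zero_mul] at h
    exact (h.eventually_lt_const hε).exists
  obtain ⟨u, rfl, y, hy, rfl⟩ := exists_mem_piece_append hK n hx
  refine ⟨u, ?_⟩
  rintro _ ⟨z, hz, rfl⟩
  calc dist (wMap f (v ++ u) z) (wMap f (v ++ u) y)
      ≤ r ^ (v ++ u).length * dist z y := dist_wMap_le hr hf _ _ _
    _ ≤ r ^ u.length * Metric.diam K := by
        refine mul_le_mul (pow_le_pow_of_le_one hr hr1.le (by simp))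
          (Metric.dist_le_diam_of_mem hKcp.isBounded hz hy) dist_nonneg (pow_nonneg hr _)
    _ < ε := hn

theorem Irred.nonempty_intK_piece {k : ℕ} {f : Fin k → X → X} {K : Set X} (h : Irred f K)
    (hcl : ∀ w, IsClosed (piece f K w)) (hK : K = ⋃ i, f i '' K) (w : List (Fin k)) :
    (intK K (piece f K w)).Nonempty := by
  obtain ⟨x, hxw, hx⟩ := Set.not_subset.mp (h w)
  have hfin : {v : List (Fin k) | v.length = w.length ∧ v ≠ w}.Finite :=
    (List.finite_length_eq (Fin k) w.length).subset fun v hv => hv.1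
  obtain ⟨ε, hε, hball⟩ := Metric.isOpen_iff.mp
    (hfin.isClosed_biUnion fun v _ => hcl v).isOpen_compl x hx
  refine ⟨x, mem_intK_iff.mpr ⟨piece_subset hK w hxw, ε, hε, ?_⟩⟩
  rintro y ⟨hy, hyK⟩
  obtain ⟨v, hv, hyv⟩ := exists_mem_piece hK w.length hyK
  by_cases hvw : v = w
  · exact hvw ▸ hyv
  · exact absurd (Set.mem_biUnion (t := fun v => piece f K v)
      (show v ∈ {v : List (Fin k) | v.length = w.length ∧ v ≠ w} from ⟨hv, hvw⟩) hyv) (hball hy)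

theorem Irred.isTiling {k : ℕ} {f : Fin k → X → X} {r : ℝ} (hr : 0 ≤ r)
    (hr1 : r < 1) (hf : ∀ i x y, dist (f i x) (f i y) ≤ r * dist x y) {K : Set X}
    (hKcp : IsCompact K) (hK : K = ⋃ i, f i '' K) (h : Irred f K) : IsTiling f K := by
  have hcl := isClosed_piece hr hf hKcp
  refine ⟨fun v w hvw hne => Set.eq_empty_iff_forall_notMem.mpr ?_, fun w => ?_⟩
  · rintro x ⟨hxv, hxw⟩
    obtain ⟨-, ε, hε, hball⟩ := mem_intK_iff.mp hxw
    obtain ⟨u, hu⟩ :=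
      exists_piece_append_subset_ball hr hr1 hf hKcp hK (intK_subset hxv) hε
    refine h (v ++ u) fun y hy => ?_
    obtain ⟨t, ht, hyt⟩ := exists_mem_piece_append hK u.length
      (hball ⟨hu hy, piece_subset hK _ hy⟩)
    exact Set.mem_biUnion (t := fun v => piece f K v)
      (show w ++ t ∈ {z : List (Fin k) | z.length = (v ++ u).length ∧ z ≠ v ++ u} from
        ⟨by simp [ht, hvw], fun he => hne (List.append_inj_left he hvw.symm).symm⟩) hyt
  · refine Set.Subset.antisymm
      (Set.inter_subset_left.trans (closure_minimal intK_subset (hcl w))) fun x hx =>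
      ⟨Metric.mem_closure_iff.mpr fun ε hε => ?_, piece_subset hK w hx⟩
    obtain ⟨u, hu⟩ := exists_piece_append_subset_ball hr hr1 hf hKcp hK hx hε
    obtain ⟨y, hy⟩ := h.nonempty_intK_piece hcl hK (w ++ u)
    exact ⟨y, intK_mono (piece_append_subset hK w u) hy,
      by rw [dist_comm]; exact hu (intK_subset hy)⟩

theorem IsTiling.irred {k : ℕ} {f : Fin k → X → X} {K : Set X} (hKne : K.Nonempty)
    (h : IsTiling f K) : Irred f K := by
  intro w hcov
  obtain ⟨x, hx⟩ : (intK K (piece f K w)).Nonempty := by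
    have hne : (closure (intK K (piece f K w)) ∩ K).Nonempty := by
      rw [h.2 w]
      exact hKne.image _
    exact closure_nonempty_iff.mp (hne.mono Set.inter_subset_left)
  obtain ⟨v, ⟨hv, hvw⟩, hxv⟩ := Set.mem_iUnion₂.mp (hcov (intK_subset hx))
  rw [← h.2 v] at hxv
  obtain ⟨y, hyo, hyv⟩ := mem_closure_iff.mp hxv.1 _ isClosed_closure.isOpen_compl hx.2
  exact (Set.eq_empty_iff_forall_notMem.mp (h.1 v w hv hvw) y) ⟨hyv, hyv.1, hyo⟩

theorem stmt_13 {X : Type*} [MetricSpace X] [CompleteSpace X]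
    {k : ℕ} (hk : 2 ≤ k) (f : Fin k → X → X) (c : Fin k → ℝ)
    (hc : ∀ i, c i ∈ Set.Ioo (0 : ℝ) 1)
    (hf : ∀ i x y, dist (f i x) (f i y) = c i * dist x y)
    (K : Set X) (hKne : K.Nonempty) (hKcp : IsCompact K)
    (hK : K = ⋃ i, f i '' K) :
    Irred f K ↔ IsTiling f K := by
  have : Nonempty (Fin k) := ⟨⟨0, by omega⟩⟩
  obtain ⟨j, hj⟩ := Finite.exists_max c
  exact ⟨Irred.isTiling (hc j).1.le (hc j).2 (fun i x y => (hf i x y).trans_le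
    (mul_le_mul_of_nonneg_right (hj i) dist_nonneg)) hKcp hK, IsTiling.irred hKne⟩

end IFSMoran
end

section
/- Let K be the attractor of an IFS of similitudes on a complete metric space with similarity dimension α, endowed with its natural fractal structure. If H⁴^α(K) > 0, then dim⁴(K) = dim³(K) = α. -/
open scoped ENNReal

namespace IFSMoran

variable {X : Type*} [MetricSpace X]

lemma edist_wMap_le {k : ℕ} {f : Fin k → X → X} {r : Fin k → ℝ≥0∞}
    (hf : ∀ i x y, edist (f i x) (f i y) ≤ r i * edist x y) (w : List (Fin k)) (x y : X) :
    edist (wMap f w x) (wMap f w y) ≤ (w.map r).prod * edist x y := by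
  induction w with
  | nil => simp [wMap]
  | cons i w ih =>
    simp only [wMap, Function.comp_apply, List.map_cons, List.prod_cons, mul_assoc]
    exact (hf i _ _).trans (by gcongr)

lemma diam_piece_le {k : ℕ} {f : Fin k → X → X} {r : Fin k → ℝ≥0∞}
    (hf : ∀ i x y, edist (f i x) (f i y) ≤ r i * edist x y) (K : Set X) (w : List (Fin k)) :
    Metric.ediam (piece f K w) ≤ (w.map r).prod * Metric.ediam K := by
  refine Metric.ediam_le ?_
  rintro _ ⟨x, hx, rfl⟩ _ ⟨y, hy, rfl⟩
  refine (edist_wMap_le hf w x y).trans ?_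
  gcongr
  exact Metric.edist_le_ediam_of_mem hx hy

lemma exists_mem_piece_ofFn {Y : Type*} {k : ℕ} {f : Fin k → Y → Y} {K : Set Y}
    (hK : K = ⋃ i, f i '' K) (l : ℕ) {x : Y} (hx : x ∈ K) :
    ∃ w : Fin l → Fin k, x ∈ piece f K (List.ofFn w) := by
  induction l generalizing x with
  | zero => exact ⟨Fin.elim0, by simpa [piece, wMap] using hx⟩
  | succ l ih =>
    rw [hK] at hx
    obtain ⟨i, y, hy, rfl⟩ := Set.mem_iUnion.1 hx
    obtain ⟨w, z, hz, rfl⟩ := ih hy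
    exact ⟨Fin.cons i w, z, hz, by simp [List.ofFn_succ, wMap]⟩

lemma H4n_le_H3n {k : ℕ} {f : Fin k → X → X} {K : Set X} (hK : K = ⋃ i, f i '' K)
    (s : ℝ) (n : ℕ) : H4n f K s n ≤ H3n f K s n := by
  classical
  refine le_iInf₂ fun l hl => ?_
  have hsum : ∑ w ∈ Finset.univ.image (List.ofFn : (Fin l → Fin k) → List (Fin k)),
      Metric.ediam (piece f K w) ^ s =
        ∑ w : Fin l → Fin k, Metric.ediam (piece f K (List.ofFn w)) ^ s :=
    Finset.sum_image fun _ _ _ _ h => List.ofFn_injective h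
  refine le_of_le_of_eq ?_ hsum
  refine iInf_le_of_le _ (iInf_le_of_le ?_ (iInf_le_of_le ?_ le_rfl))
  · simp [hl]
  · intro x hx
    obtain ⟨w, hw⟩ := exists_mem_piece_ofFn hK l hx
    exact Set.mem_biUnion (Finset.mem_coe.2 (Finset.mem_image_of_mem _ (Finset.mem_univ w))) hw

lemma H4_le_H3 {k : ℕ} {f : Fin k → X → X} {K : Set X} (hK : K = ⋃ i, f i '' K)
    (s : ℝ) : H4 f K s ≤ H3 f K s :=
  iSup_mono fun n => H4n_le_H3n hK s n

lemma H4n_mono {k : ℕ} (f : Fin k → X → X) (K : Set X) (s : ℝ) : Monotone (H4n f K s) :=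
  fun _ _ hnm => le_iInf fun 𝒜 => le_iInf₂ fun h𝒜 hcov =>
    iInf_le_of_le 𝒜 (iInf_le_of_le (fun w hw => hnm.trans (h𝒜 w hw)) (iInf_le _ hcov))

open Filter Topology in
lemma exists_diam_piece_le_one {k : ℕ} {f : Fin k → X → X} {r : Fin k → ℝ≥0∞}
    (hr : ∀ i, r i < 1) (hf : ∀ i x y, edist (f i x) (f i y) ≤ r i * edist x y)
    {K : Set X} (hK : Metric.ediam K ≠ ∞) :
    ∃ N, ∀ w : List (Fin k), N ≤ w.length → Metric.ediam (piece f K w) ≤ 1 := by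
  set m := Finset.univ.sup r with hm
  have hm1 : m < 1 := (Finset.sup_lt_iff (by simp)).2 fun i _ => hr i
  have hlim : Tendsto (fun n : ℕ => m ^ n * Metric.ediam K) atTop (𝓝 0) := by
    simpa using ENNReal.Tendsto.mul_const (ENNReal.tendsto_pow_atTop_nhds_zero_of_lt_one hm1)
      (Or.inr hK)
  obtain ⟨N, hN⟩ := eventually_atTop.1 (hlim.eventually_le_const one_pos)
  refine ⟨N, fun w hw => (diam_piece_le hf K w).trans (le_trans ?_ (hN _ hw))⟩
  gcongr
  simpa using List.prod_le_pow_card (w.map r) m (by simp [hm, Finset.le_sup])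

lemma H4_le_H4_of_exponent_le {k : ℕ} {f : Fin k → X → X} {K : Set X} {N : ℕ}
    (hN : ∀ w : List (Fin k), N ≤ w.length → Metric.ediam (piece f K w) ≤ 1)
    {s t : ℝ} (hst : s ≤ t) : H4 f K t ≤ H4 f K s := by
  refine iSup_le fun n => ?_
  refine (H4n_mono f K t (le_max_left n N)).trans (le_iSup_of_le (max n N) ?_)
  refine iInf_mono fun 𝒜 => iInf₂_mono fun h𝒜 _ => Finset.sum_le_sum fun w hw => ?_
  exact ENNReal.rpow_le_rpow_of_exponent_ge (hN w ((le_max_right n N).trans (h𝒜 w hw))) hst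

lemma sum_diam_piece_rpow_le {k : ℕ} {f : Fin k → X → X} {r : Fin k → ℝ≥0∞}
    (hf : ∀ i x y, edist (f i x) (f i y) ≤ r i * edist x y) (K : Set X) {s : ℝ} (hs : 0 ≤ s)
    (l : ℕ) :
    ∑ w : Fin l → Fin k, Metric.ediam (piece f K (List.ofFn w)) ^ s ≤
      (∑ i, r i ^ s) ^ l * Metric.ediam K ^ s := by
  rw [Fintype.sum_pow, Finset.sum_mul]
  refine Finset.sum_le_sum fun w _ => ?_
  rw [ENNReal.prod_rpow_of_nonneg hs, ← ENNReal.mul_rpow_of_nonneg _ _ hs]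
  refine ENNReal.rpow_le_rpow ((diam_piece_le hf K _).trans_eq ?_) hs
  rw [List.map_ofFn, List.prod_ofFn]
  rfl

open Filter Topology in
lemma H3_eq_zero {k : ℕ} {f : Fin k → X → X} {r : Fin k → ℝ≥0∞}
    (hf : ∀ i x y, edist (f i x) (f i y) ≤ r i * edist x y) {K : Set X}
    (hK : Metric.ediam K ≠ ∞) {s : ℝ} (hs : 0 ≤ s) (hsum : ∑ i, r i ^ s < 1) :
    H3 f K s = 0 := by
  have hlim : Tendsto (fun l : ℕ => (∑ i, r i ^ s) ^ l * Metric.ediam K ^ s) atTop (𝓝 0) := by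
    simpa using ENNReal.Tendsto.mul_const
      (ENNReal.tendsto_pow_atTop_nhds_zero_of_lt_one hsum)
      (Or.inr (ENNReal.rpow_ne_top_of_nonneg hs hK))
  refine ENNReal.iSup_eq_zero.2 fun n => le_antisymm ?_ zero_le
  refine ge_of_tendsto hlim ((eventually_ge_atTop n).mono fun l hl => ?_)
  exact (iInf₂_le l hl).trans (sum_diam_piece_rpow_le hf K hs l)

lemma sum_ofReal_rpow_lt_one {k : ℕ} (hk : 0 < k) {c : Fin k → ℝ}
    (hc : ∀ i, c i ∈ Set.Ioo (0 : ℝ) 1) {α s : ℝ} (hα : ∑ i, c i ^ α = 1) (hs : α < s) :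
    ∑ i, ENNReal.ofReal (c i) ^ s < 1 := by
  have hlt : ∑ i, c i ^ s < 1 := by
    rw [← hα]
    exact Finset.sum_lt_sum_of_nonempty ⟨⟨0, hk⟩, Finset.mem_univ _⟩ fun i _ =>
      Real.rpow_lt_rpow_of_exponent_gt (hc i).1 (hc i).2 hs
  have heq : ∑ i, ENNReal.ofReal (c i) ^ s = ENNReal.ofReal (∑ i, c i ^ s) := by
    rw [ENNReal.ofReal_sum_of_nonneg fun i _ => Real.rpow_nonneg (hc i).1.le s]
    exact Finset.sum_congr rfl fun i _ => ENNReal.ofReal_rpow_of_pos (hc i).1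
  rw [heq]
  exact ENNReal.ofReal_lt_one.2 hlt

theorem stmt_14 {X : Type*} [MetricSpace X] [CompleteSpace X]
    {k : ℕ} (hk : 2 ≤ k) (f : Fin k → X → X) (c : Fin k → ℝ)
    (hc : ∀ i, c i ∈ Set.Ioo (0 : ℝ) 1)
    (hf : ∀ i x y, dist (f i x) (f i y) = c i * dist x y)
    (K : Set X) (hKne : K.Nonempty) (hKcp : IsCompact K)
    (hK : K = ⋃ i, f i '' K)
    (α : ℝ) (hα : 0 < α) (hαsum : ∑ i, c i ^ α = 1)
    (hpos : 0 < H4 f K α) :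
    dim4 f K = α ∧ dim3 f K = α := by
  have hf' : ∀ i x y, edist (f i x) (f i y) ≤ ENNReal.ofReal (c i) * edist x y := by
    intro i x y
    rw [edist_dist, edist_dist, hf, ENNReal.ofReal_mul (hc i).1.le]
  have hdiam : Metric.ediam K ≠ ∞ := hKcp.isBounded.ediam_ne_top
  obtain ⟨N, hN⟩ := exists_diam_piece_le_one (fun i => ENNReal.ofReal_lt_one.2 (hc i).2) hf' hdiam
  have hlow : ∀ s ≤ α, 0 < H4 f K s := fun s hs =>
    hpos.trans_le (H4_le_H4_of_exponent_le hN hs)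
  have hhigh : ∀ s, α < s → H3 f K s = 0 := fun s hs =>
    H3_eq_zero hf' hdiam (hα.trans hs).le
      (sum_ofReal_rpow_lt_one (by lia) hc hαsum hs)
  have h4 : {s : ℝ | 0 ≤ s ∧ H4 f K s = 0} = Set.Ioi α := by
    ext s
    refine ⟨fun h => Set.mem_Ioi.2 <| lt_of_not_ge fun hs => (hlow s hs).ne' h.2, fun hs => ?_⟩
    exact ⟨(hα.trans hs).le, le_antisymm ((H4_le_H3 hK s).trans_eq (hhigh s hs)) zero_le⟩
  have h3 : {s : ℝ | 0 ≤ s ∧ H3 f K s = 0} = Set.Ioi α := by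
    ext s
    refine ⟨fun h => Set.mem_Ioi.2 <| lt_of_not_ge fun hs => ?_,
      fun hs => ⟨(hα.trans hs).le, hhigh s hs⟩⟩
    exact ((hlow s hs).trans_le (H4_le_H3 hK s)).ne' h.2
  rw [dim4, dim3, h4, h3, csInf_Ioi]
  exact ⟨rfl, rfl⟩

end IFSMoran
end
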